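/- arXiv:math/0404055 — 5 statements merged into one kernel-verified Lean document; each statement's English description precedes it below -/
import Mathlib

section
/- Let p > 1, a ≥ 1, and (p−1)a = q − 2. Suppose F ∈ C²([0,T)) satisfies, for all t ≥ T₀ > 0, (a) F(t) ≥ K₀ (t+R)^a and (b) F''(t) ≥ K₁ (t+R)^{−q} [F(t)]^p, with positive constants K₀, K₁, T₀, R. Then, with K₁ fixed, there exists a positive constant c₀, independent of R and T₀, such that if K₀ ≥ c₀ then T < ∞. -/
open MeasureTheory Set ENNReal Filter

/-- The time interval `[0, T)`, where `T : ℝ≥0∞` may be infinite. -/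
def timeSet (T : ℝ≥0∞) : Set ℝ := {t : ℝ | 0 ≤ t ∧ ENNReal.ofReal t < T}

/-- A function whose derivative is at least `1` wherever it is nonpositive is eventually
nonnegative. -/
lemma exists_forall_ge_nonneg_of_one_le_deriv {H H' : ℝ → ℝ} {s₀ : ℝ}
    (hH : ∀ s, s₀ ≤ s → HasDerivAt H (H' s) s)
    (h1 : ∀ s, s₀ ≤ s → H s ≤ 0 → 1 ≤ H' s) :
    ∃ s₁, s₀ ≤ s₁ ∧ ∀ s, s₁ ≤ s → 0 ≤ H s := by
  obtain ⟨s₁, hs₁, hpos⟩ : ∃ s₁, s₀ ≤ s₁ ∧ 0 ≤ H s₁ := by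
    by_contra! hneg
    have hmono : MonotoneOn (fun s => H s - s) (Ici s₀) := by
      refine monotoneOn_of_hasDerivWithinAt_nonneg (f' := fun s => H' s - 1) (convex_Ici s₀)
        (fun s hs => ((hH s hs).sub (hasDerivAt_id s)).continuousAt.continuousWithinAt) ?_ ?_
      · intro s hs
        exact ((hH s (interior_subset hs)).sub (hasDerivAt_id s)).hasDerivWithinAt
      · intro s hs
        have hs' : s₀ ≤ s := interior_subset hs
        linarith [h1 s hs' (hneg s hs').le]
    have hle : s₀ ≤ s₀ - H s₀ := by linarith [hneg s₀ le_rfl]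
    have := hmono self_mem_Ici (mem_Ici.2 hle) hle
    dsimp only at this
    linarith [hneg _ hle]
  refine ⟨s₁, hs₁, fun s hs => ?_⟩
  have := image_le_of_deriv_right_lt_deriv_boundary (f := fun x => -H x) (f' := fun x => -H' x)
    (B := fun _ => 0) (B' := fun _ => 0) (a := s₁) (b := s)
    (fun x hx => (hH x (hs₁.trans hx.1)).neg.continuousAt.continuousWithinAt)
    (fun x hx => (hH x (hs₁.trans hx.1)).neg.hasDerivWithinAt) (by simpa using hpos)
    (fun x => hasDerivAt_const x 0)
    (fun x hx hx0 => by
      have := h1 x (hs₁.trans hx.1) (by linarith)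
      linarith) (right_mem_Icc.2 hs)
  linarith

/-- The inequality `G' ≥ ε G ^ r` with `r > 1` has no global positive solution. -/
lemma not_forall_rpow_le_deriv {G G' : ℝ → ℝ} {s₁ ε r : ℝ} (hε : 0 < ε) (hr : 1 < r)
    (hG : ∀ s, s₁ ≤ s → HasDerivAt G (G' s) s) (hpos : ∀ s, s₁ ≤ s → 0 < G s)
    (hle : ∀ s, s₁ ≤ s → ε * G s ^ r ≤ G' s) : False := by
  have hd : ∀ s, s₁ ≤ s → HasDerivAt (fun s => G s ^ (1 - r) + (r - 1) * ε * s)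
      (G' s * (1 - r) * G s ^ (1 - r - 1) + (r - 1) * ε * 1) s := fun s hs =>
    ((hG s hs).rpow_const (Or.inl (hpos s hs).ne')).add ((hasDerivAt_id s).const_mul _)
  have hanti : AntitoneOn (fun s => G s ^ (1 - r) + (r - 1) * ε * s) (Ici s₁) := by
    refine antitoneOn_of_hasDerivWithinAt_nonpos (convex_Ici s₁)
      (fun s hs => (hd s hs).continuousAt.continuousWithinAt)
      (fun s hs => (hd s (interior_subset hs)).hasDerivWithinAt) ?_
    intro s hs
    have hs' : s₁ ≤ s := interior_subset hs
    have hg := hpos s hs'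
    have hprod : G s ^ r * G s ^ (1 - r - 1) = 1 := by
      rw [← Real.rpow_add hg]; simp
    have hmul : ε ≤ G' s * G s ^ (1 - r - 1) := by
      calc ε = ε * G s ^ r * G s ^ (1 - r - 1) := by rw [mul_assoc, hprod, mul_one]
        _ ≤ _ := mul_le_mul_of_nonneg_right (hle s hs') (by positivity)
    nlinarith
  have hk : 0 < (r - 1) * ε := mul_pos (by linarith) hε
  have hg₁ : 0 < G s₁ ^ (1 - r) := Real.rpow_pos_of_pos (hpos s₁ le_rfl) _
  set s := s₁ + G s₁ ^ (1 - r) / ((r - 1) * ε) with hs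
  have hs₁ : s₁ ≤ s := by rw [hs]; linarith [div_pos hg₁ hk]
  have h := hanti self_mem_Ici (mem_Ici.2 hs₁) hs₁
  have hg : 0 < G s ^ (1 - r) := Real.rpow_pos_of_pos (hpos s hs₁) _
  have heq : (r - 1) * ε * s = (r - 1) * ε * s₁ + G s₁ ^ (1 - r) := by
    rw [hs, mul_add, mul_div_cancel₀ _ hk.ne']
  dsimp only at h
  linarith

/-- The autonomous inequality `G'' + (2a-1) G' + a(a-1) G ≥ K G ^ p` has no global solution
that stays above a large enough threshold. -/
lemma exists_threshold_autonomous {p a K : ℝ} (hp : 1 < p) (ha : 1 ≤ a) (hK : 0 < K) :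
    ∃ c₀ : ℝ, 0 < c₀ ∧ ∀ (s₀ : ℝ) (G G' G'' : ℝ → ℝ),
      (∀ s, s₀ ≤ s → HasDerivAt G (G' s) s) → (∀ s, s₀ ≤ s → HasDerivAt G' (G'' s) s) →
      (∀ s, s₀ ≤ s → c₀ ≤ G s) →
      (∀ s, s₀ ≤ s → K * G s ^ p ≤ G'' s + (2 * a - 1) * G' s + a * (a - 1) * G s) → False := by
  obtain ⟨r, hr⟩ : ∃ r, r = (p + 1) / 2 := ⟨_, rfl⟩
  have hr1 : 1 < r := by linarith
  obtain ⟨ε, hε, hεr⟩ : ∃ ε : ℝ, 0 < ε ∧ ε * ε * r = K / 2 := by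
    refine ⟨√(K / (2 * r)), Real.sqrt_pos.2 (by positivity), ?_⟩
    rw [Real.mul_self_sqrt (by positivity)]
    field_simp
  obtain ⟨u₀, hu₀⟩ : ∃ u₀, u₀ = max 1 (2 / K * ((2 * a - 1) * ε + a * (a - 1) + 1)) := ⟨_, rfl⟩
  have hu1 : 1 ≤ u₀ := hu₀ ▸ le_max_left _ _
  have hu2 : (2 * a - 1) * ε + a * (a - 1) + 1 ≤ K / 2 * u₀ := by
    have h := mul_le_mul_of_nonneg_left (hu₀ ▸ le_max_right 1 _ :
      2 / K * ((2 * a - 1) * ε + a * (a - 1) + 1) ≤ u₀) (half_pos hK).le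
    rwa [← mul_assoc, show K / 2 * (2 / K) = 1 by field_simp, one_mul] at h
  have hc1 : 1 ≤ u₀ ^ (r - 1)⁻¹ :=
    Real.one_le_rpow hu1 (inv_nonneg.2 (by linarith))
  refine ⟨u₀ ^ (r - 1)⁻¹, by positivity, fun s₀ G G' G'' hG hG' hc hode => ?_⟩
  have hpos : ∀ s, s₀ ≤ s → 0 < G s := fun s hs => by linarith [hc s hs]
  obtain ⟨s₁, hs₁, hnn⟩ := exists_forall_ge_nonneg_of_one_le_deriv
    (H := fun s => G' s - ε * G s ^ r) (H' := fun s => G'' s - ε * (G' s * r * G s ^ (r - 1)))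
    (s₀ := s₀)
    (fun s hs => (hG' s hs).sub (((hG s hs).rpow_const (Or.inl (hpos s hs).ne')).const_mul ε))
    (fun s hs hH => by
      have hg := hpos s hs
      have hg1 : 1 ≤ G s := hc1.trans (hc s hs)
      obtain ⟨u, hu⟩ : ∃ u, u = G s ^ (r - 1) := ⟨_, rfl⟩
      have huu : u₀ ≤ u := by
        have h := Real.rpow_le_rpow (by positivity) (hc s hs) (by linarith : 0 ≤ r - 1)
        rwa [Real.rpow_inv_rpow (by linarith) (by linarith), ← hu] at h
      have hGr : G s ^ r = G s * u := by
        rw [hu, ← Real.rpow_one_add' hg.le (by linarith)]; ring_nf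
      have hGp : G s ^ p = G s * u * u := by
        rw [← hGr, hu, ← Real.rpow_add hg]; congr 1; linarith
      have ho := hode s hs
      rw [hGp] at ho
      rw [hGr] at hH
      rw [← hu]
      have hu0 : 1 ≤ u := hu1.trans huu
      have hcoef : 0 ≤ (2 * a - 1) + ε * r * u := by
        have : 0 < ε * r * u := by positivity
        linarith
      have hbar := mul_nonneg hcoef (sub_nonneg.2 (sub_nonpos.1 hH))
      have hquad : 1 ≤ K / 2 * u * u - (2 * a - 1) * ε * u - a * (a - 1) := by
        have hKu : (2 * a - 1) * ε + a * (a - 1) + 1 ≤ K / 2 * u :=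
          hu2.trans (mul_le_mul_of_nonneg_left huu (half_pos hK).le)
        have haa : 0 ≤ a * (a - 1) := mul_nonneg (by linarith) (by linarith)
        nlinarith [mul_le_mul_of_nonneg_right hKu (by linarith : 0 ≤ u),
          mul_nonneg haa (sub_nonneg.2 hu0)]
      have hGq := mul_le_mul_of_nonneg_left hquad hg.le
      have hεG : ε * r * u * (ε * (G s * u)) = K / 2 * (G s * u * u) := by
        rw [← hεr]; ring
      have hexp : ((2 * a - 1) + ε * r * u) * (ε * (G s * u) - G' s) =
          (2 * a - 1) * ε * u * G s + K / 2 * (G s * u * u) - (2 * a - 1) * G' s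
            - ε * (G' s * r * u) := by
        rw [← hεG]; ring
      linarith)
  exact not_forall_rpow_le_deriv hε hr1 (fun s hs => hG s (hs₁.trans hs))
    (fun s hs => hpos s (hs₁.trans hs)) (fun s hs => sub_nonneg.1 (hnn s hs))

/-- **ODE blow-up lemma (Lemma 2.1).**
Let `p > 1`, `a ≥ 1` and `(p-1)a = q - 2`.  Fixing `K₁ > 0`, there is a constant `c₀ > 0`,
independent of `R` and `T₀`, such that: whenever `F ∈ C²([0,T))` satisfies, for all
`t ≥ T₀ > 0`, the inequalities `F(t) ≥ K₀ (t+R)^a` and `F''(t) ≥ K₁ (t+R)^{-q} F(t)^p`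
with `K₀ ≥ c₀`, then `T < ∞`. -/
theorem ode_blowup
    (p a q K₁ : ℝ) (hp : 1 < p) (ha : 1 ≤ a) (hq : (p - 1) * a = q - 2) (hK₁ : 0 < K₁) :
    ∃ c₀ : ℝ, 0 < c₀ ∧
      ∀ (T : ℝ≥0∞) (F : ℝ → ℝ) (K₀ T₀ R : ℝ), 0 < K₀ → 0 < T₀ → 0 < R →
        ContDiffOn ℝ 2 F (timeSet T) →
        (∀ t : ℝ, T₀ ≤ t → ENNReal.ofReal t < T → K₀ * (t + R) ^ a ≤ F t) →
        (∀ t : ℝ, T₀ ≤ t → ENNReal.ofReal t < T →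
          K₁ * (t + R) ^ (-q) * F t ^ p ≤ iteratedDeriv 2 F t) →
        c₀ ≤ K₀ → T < ⊤ := by
  obtain ⟨c₀, hc₀, hmain⟩ := exists_threshold_autonomous hp ha hK₁
  refine ⟨c₀, hc₀, fun T F K₀ T₀ R _ hT₀ hR hF hlow hode hcK => ?_⟩
  by_contra hT
  obtain rfl : T = ⊤ := not_lt_top_iff.1 hT
  have hF' : ContDiffOn ℝ (1 + 1) F (Ioi 0) := by
    refine (hF.mono fun t ht => ⟨le_of_lt ht, ofReal_lt_top⟩).of_le ?_
    norm_num
  rw [contDiffOn_succ_iff_deriv_of_isOpen isOpen_Ioi] at hF'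
  have hd1 : ∀ t, 0 < t → HasDerivAt F (deriv F t) t := fun t ht =>
    (hF'.1.differentiableAt (Ioi_mem_nhds ht)).hasDerivAt
  have hd2 : ∀ t, 0 < t → HasDerivAt (deriv F) (iteratedDeriv 2 F t) t := fun t ht => by
    rw [iteratedDeriv_succ, iteratedDeriv_one]
    exact ((hF'.2.2.differentiableOn one_ne_zero).differentiableAt (Ioi_mem_nhds ht)).hasDerivAt
  have hs : ∀ s, Real.log (T₀ + R) ≤ s → T₀ ≤ Real.exp s - R := fun s hs => by
    linarith [(Real.log_le_iff_le_exp (by linarith)).1 hs]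
  have hexp : ∀ b s : ℝ, HasDerivAt (fun s => Real.exp (b * s)) (Real.exp (b * s) * (b * 1)) s :=
    fun b s => ((hasDerivAt_id s).const_mul b).exp
  have hpow : ∀ b s : ℝ, Real.exp s ^ b = Real.exp (b * s) := fun b s => by
    rw [← Real.exp_mul, mul_comm]
  -- The substitution `t + R = exp s`, `F t = (t + R) ^ a * G s` makes the inequality autonomous.
  refine hmain (Real.log (T₀ + R)) (fun s => Real.exp (-a * s) * F (Real.exp s - R))
    (fun s => Real.exp (-a * s) * (-a * 1) * F (Real.exp s - R) +
      Real.exp (-a * s) * (deriv F (Real.exp s - R) * Real.exp s))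
    (fun s => (Real.exp (-a * s) * (-a * 1) * (-a * 1) * F (Real.exp s - R) +
        Real.exp (-a * s) * (-a * 1) * (deriv F (Real.exp s - R) * Real.exp s)) +
      (Real.exp (-a * s) * (-a * 1) * (deriv F (Real.exp s - R) * Real.exp s) +
        Real.exp (-a * s) * (iteratedDeriv 2 F (Real.exp s - R) * Real.exp s * Real.exp s +
          deriv F (Real.exp s - R) * Real.exp s))) ?_ ?_ ?_ ?_
  · intro s h
    exact (hexp (-a) s).mul
      ((hd1 _ (hT₀.trans_le (hs s h))).comp s ((Real.hasDerivAt_exp s).sub_const R))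
  · intro s h
    have ht := hT₀.trans_le (hs s h)
    have e := (Real.hasDerivAt_exp s).sub_const R
    have hcomp : HasDerivAt (fun s => deriv F (Real.exp s - R))
        (iteratedDeriv 2 F (Real.exp s - R) * Real.exp s) s :=
      HasDerivAt.comp (h₂ := deriv F) (h := fun s => Real.exp s - R) s (hd2 _ ht) e
    exact (((hexp (-a) s).mul_const (-a * 1)).mul ((hd1 _ ht).comp s e)).add
      ((hexp (-a) s).mul (hcomp.mul (Real.hasDerivAt_exp s)))
  · intro s h
    have hl := hlow _ (hs s h) ofReal_lt_top
    rw [sub_add_cancel, hpow] at hl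
    have hm := mul_le_mul_of_nonneg_left hl (Real.exp_pos (-a * s)).le
    rw [mul_left_comm, ← Real.exp_add, show -a * s + a * s = 0 by ring, Real.exp_zero,
      mul_one] at hm
    exact hcK.trans hm
  · intro s h
    have hl := hlow _ (hs s h) ofReal_lt_top
    have ho := hode _ (hs s h) ofReal_lt_top
    rw [sub_add_cancel, hpow] at hl ho
    have hF0 : 0 ≤ F (Real.exp s - R) :=
      (mul_nonneg (hc₀.le.trans hcK) (Real.exp_pos _).le).trans hl
    have hm := mul_le_mul_of_nonneg_left ho
      (mul_pos (mul_pos (Real.exp_pos (-a * s)) (Real.exp_pos s)) (Real.exp_pos s)).le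
    have hE : Real.exp (-a * s) ^ p =
        Real.exp (-a * s) * Real.exp s * Real.exp s * Real.exp (-q * s) := by
      rw [hpow, ← Real.exp_add, ← Real.exp_add, ← Real.exp_add]
      congr 1
      linear_combination (-s) * hq
    rw [Real.mul_rpow (Real.exp_pos _).le hF0, hE]
    linarith
end

section
/- For every t ∈ [0,T), F₀ is twice differentiable and F₀''(t) = ∫_{ℝⁿ} |u(x,t)|^p dx. -/
open MeasureTheory Metric Set ENNReal Filter

noncomputable section

/-- The Laplacian of `f : ℝⁿ → ℝ`, as the sum of the second derivatives along the
coordinate directions. -/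
def lap (n : ℕ) (f : EuclideanSpace ℝ (Fin n) → ℝ) (x : EuclideanSpace ℝ (Fin n)) : ℝ :=
  ∑ i : Fin n, iteratedDeriv 2 (fun s : ℝ => f (x + s • EuclideanSpace.single i (1 : ℝ))) 0

open Topology

/-- A time slice of a jointly continuous function is continuous. -/
lemma continuous_slice {E : Type*} [TopologicalSpace E] {f : E × ℝ → ℝ} {S : Set ℝ}
    (hf : ContinuousOn f (univ ×ˢ S)) {t : ℝ} (ht : t ∈ S) :
    Continuous fun x => f (x, t) :=
  continuousOn_univ.1 <| hf.comp (by fun_prop) fun _ _ => ⟨mem_univ _, ht⟩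

section ParametricIntegral

variable {E : Type*} [NormedAddCommGroup E] [MeasurableSpace E] [BorelSpace E]
  {μ : Measure E} [IsFiniteMeasureOnCompacts μ] {f g : E × ℝ → ℝ} {a b : ℝ} {K : Set E}

lemma integrable_of_continuous_of_eq_zero {h : E → ℝ} (hK : IsCompact K) (hh : Continuous h)
    (h0 : ∀ x ∉ K, h x = 0) : Integrable h μ :=
  hh.integrable_of_hasCompactSupport (HasCompactSupport.intro hK fun x hx => h0 x hx)

lemma continuousOn_integral_slice {S : Set ℝ} (hK : IsCompact K)
    (hf : ContinuousOn f (univ ×ˢ S)) (hfK : ∀ x ∉ K, ∀ t ∈ S, f (x, t) = 0) :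
    ContinuousOn (fun s => ∫ x, f (x, s) ∂μ) S :=
  continuousOn_integral_of_compact_support (f := fun s x => f (x, s)) hK
    (hf.comp (by fun_prop) fun q hq => ⟨mem_univ _, hq.1⟩) fun s x hs hx => hfK x hx s hs

/-- Differentiation under the integral sign at an interior time. -/
lemma hasDerivAt_integral_slice (hK : IsCompact K)
    (hf : ContinuousOn f (univ ×ˢ Icc a b)) (hg : ContinuousOn g (univ ×ˢ Icc a b))
    (hd : ∀ x, ∀ t ∈ Ioo a b, HasDerivAt (fun s => f (x, s)) (g (x, t)) t)
    (hfK : ∀ x ∉ K, ∀ t ∈ Icc a b, f (x, t) = 0) (hgK : ∀ x ∉ K, ∀ t ∈ Icc a b, g (x, t) = 0)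
    {t : ℝ} (ht : t ∈ Ioo a b) :
    HasDerivAt (fun s => ∫ x, f (x, s) ∂μ) (∫ x, g (x, t) ∂μ) t := by
  have hnhds : Ioo a b ∈ 𝓝 t := Ioo_mem_nhds ht.1 ht.2
  have ht' := Ioo_subset_Icc_self ht
  obtain ⟨C, hC⟩ := (hK.prod (isCompact_Icc (a := a) (b := b))).exists_bound_of_continuousOn
    (hg.mono (prod_mono_left (subset_univ K)))
  refine (hasDerivAt_integral_of_dominated_loc_of_deriv_le (F := fun s x => f (x, s))
    (F' := fun s x => g (x, s)) (bound := K.indicator fun _ => C) hnhds ?_ ?_ ?_ ?_ ?_ ?_).2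
  · filter_upwards [hnhds] with s hs
    exact (continuous_slice hf (Ioo_subset_Icc_self hs)).aestronglyMeasurable
  · exact integrable_of_continuous_of_eq_zero hK (continuous_slice hf ht')
      fun x hx => hfK x hx t ht'
  · exact (continuous_slice hg ht').aestronglyMeasurable
  · refine Eventually.of_forall fun x s hs => ?_
    by_cases hx : x ∈ K
    · simpa [hx] using hC (x, s) ⟨hx, Ioo_subset_Icc_self hs⟩
    · simp [hx, hgK x hx s (Ioo_subset_Icc_self hs)]
  · exact (integrable_indicator_iff hK.measurableSet).2 (integrableOn_const hK.measure_ne_top)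
  · exact Eventually.of_forall fun x s hs => hd x s hs

/-- Differentiation under the integral sign, up to the initial time. -/
lemma hasDerivWithinAt_integral_slice (hK : IsCompact K)
    (hf : ContinuousOn f (univ ×ˢ Icc a b)) (hg : ContinuousOn g (univ ×ˢ Icc a b))
    (hd : ∀ x, ∀ t ∈ Ioo a b, HasDerivAt (fun s => f (x, s)) (g (x, t)) t)
    (hfK : ∀ x ∉ K, ∀ t ∈ Icc a b, f (x, t) = 0) (hgK : ∀ x ∉ K, ∀ t ∈ Icc a b, g (x, t) = 0)
    {t : ℝ} (ht : t ∈ Ico a b) :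
    HasDerivWithinAt (fun s => ∫ x, f (x, s) ∂μ) (∫ x, g (x, t) ∂μ) (Ici a) t := by
  have hint := fun t ht => hasDerivAt_integral_slice (μ := μ) hK hf hg hd hfK hgK (t := t) ht
  obtain rfl | hat := ht.1.eq_or_lt
  swap
  · exact (hint t ⟨hat, ht.2⟩).hasDerivWithinAt
  have hmem : Ioo a b ∈ 𝓝[>] a := Ioo_mem_nhdsGT ht.2
  have haI : a ∈ Icc a b := left_mem_Icc.2 ht.2.le
  have hF := continuousOn_integral_slice (μ := μ) hK hf hfK
  have hG := continuousOn_integral_slice (μ := μ) hK hg hgK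
  refine hasDerivWithinAt_Ici_of_tendsto_deriv
    (fun s hs => (hint s hs).differentiableAt.differentiableWithinAt)
    ((hF a haI).mono Ioo_subset_Icc_self) hmem ?_
  have hlim : Tendsto (fun s => ∫ x, g (x, s) ∂μ) (𝓝[>] a) (𝓝 (∫ x, g (x, a) ∂μ)) := by
    refine (hG a haI).mono_left ?_
    rw [← nhdsWithin_Ioo_eq_nhdsGT ht.2]
    exact nhdsWithin_mono _ Ioo_subset_Icc_self
  refine hlim.congr' ?_
  filter_upwards [hmem] with s hs
  exact (hint s hs).deriv.symm

end ParametricIntegral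

section LineDeriv

variable {E : Type*} [NormedAddCommGroup E] [NormedSpace ℝ E] {h h' : E → ℝ} {e : E}

lemma hasLineDerivAt_eq_zero_of_norm_gt {r : ℝ} (hh : ∀ x, r < ‖x‖ → h x = 0)
    {c : ℝ} {x : E} (hd : HasLineDerivAt ℝ h c x e) (hx : r < ‖x‖) : c = 0 := by
  have hev : (fun s : ℝ => h (x + s • e)) =ᶠ[𝓝 0] fun _ => 0 := by
    have hc : ContinuousAt (fun s : ℝ => ‖x + s • e‖) 0 := by fun_prop
    filter_upwards [hc.eventually_const_lt (u := r) (by simpa using hx)] with s hs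
    exact hh _ hs
  exact HasDerivAt.unique hd ((hasDerivAt_const (0 : ℝ) (0 : ℝ)).congr_of_eventuallyEq hev)

/-- The integral of a directional derivative of a compactly supported function vanishes. -/
lemma integral_lineDeriv_eq_zero [FiniteDimensional ℝ E] [MeasurableSpace E] [BorelSpace E]
    {μ : Measure E} [μ.IsAddHaarMeasure] {r : ℝ} (hc : Continuous h) (hc' : Continuous h')
    (hh : ∀ x, r < ‖x‖ → h x = 0) (hh' : ∀ x, r < ‖x‖ → h' x = 0)
    (hd : ∀ x, HasLineDerivAt ℝ h (h' x) x e) : ∫ x, h' x ∂μ = 0 := by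
  have hK : IsCompact (closedBall (0 : E) r) := isCompact_closedBall 0 r
  have hi := integrable_of_continuous_of_eq_zero (μ := μ) hK hc
    fun x hx => hh x (by simpa using hx)
  have hi' := integrable_of_continuous_of_eq_zero (μ := μ) hK hc'
    fun x hx => hh' x (by simpa using hx)
  have key := integral_bilinear_hasLineDerivAt_right_eq_neg_left_of_integrable (μ := μ)
    (f := fun _ : E => (1 : ℝ)) (f' := fun _ => 0) (g := h) (g' := h') (v := e)
    (B := ContinuousLinearMap.mul ℝ ℝ) (by simp) (by simpa using hi') (by simpa using hi)
    (fun x _ => by simpa [HasLineDerivAt] using hasDerivAt_const (0 : ℝ) (1 : ℝ))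
    (fun x _ => hd x)
  simpa using key

end LineDeriv

lemma iteratedDeriv_two_eq {h h' : ℝ → ℝ} {c t : ℝ} (hd : ∀ᶠ s in 𝓝 t, HasDerivAt h (h' s) s)
    (hd' : HasDerivAt h' c t) : iteratedDeriv 2 h t = c := by
  rw [iteratedDeriv_succ, iteratedDeriv_one]
  have hev : deriv h =ᶠ[𝓝 t] h' := hd.mono fun s hs => hs.deriv
  rw [hev.deriv_eq, hd'.deriv]

section DirectionalDerivative

variable {E : Type*} [NormedAddCommGroup E] [NormedSpace ℝ E] {S : Set ℝ} {f : E × ℝ → ℝ} {k : ℕ}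

lemma exists_contDiffOn_dirDeriv (hS : UniqueDiffOn ℝ S)
    (hf : ContDiffOn ℝ (k + 1 : ℕ) f (univ ×ˢ S)) (d : E × ℝ) :
    ∃ g : E × ℝ → ℝ, ContDiffOn ℝ k g (univ ×ˢ S) ∧
      ∀ q ∈ univ ×ˢ S, ∃ L : E × ℝ →L[ℝ] ℝ, HasFDerivWithinAt f L (univ ×ˢ S) q ∧ L d = g q := by
  refine ⟨fun q => fderivWithin ℝ f (univ ×ˢ S) q d, ?_, fun q hq => ⟨_, ?_, rfl⟩⟩
  · exact (hf.fderivWithin (uniqueDiffOn_univ.prod hS) (by norm_cast)).clm_apply contDiffOn_const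
  · exact ((hf.differentiableOn (by simp)) q hq).hasFDerivWithinAt

lemma exists_contDiffOn_timeDeriv (hS : UniqueDiffOn ℝ S)
    (hf : ContDiffOn ℝ (k + 1 : ℕ) f (univ ×ˢ S)) :
    ∃ g : E × ℝ → ℝ, ContDiffOn ℝ k g (univ ×ˢ S) ∧
      ∀ x, ∀ t ∈ S, HasDerivWithinAt (fun s => f (x, s)) (g (x, t)) S t := by
  obtain ⟨g, hg, hd⟩ := exists_contDiffOn_dirDeriv hS hf (0, 1)
  refine ⟨g, hg, fun x t ht => ?_⟩
  obtain ⟨L, hL, hLg⟩ := hd (x, t) ⟨mem_univ _, ht⟩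
  rw [← hLg]
  exact hL.comp_hasDerivWithinAt t
    ((hasDerivWithinAt_const t S x).prodMk (hasDerivWithinAt_id t S)) fun s hs => ⟨mem_univ _, hs⟩

lemma exists_contDiffOn_spaceDeriv (hS : UniqueDiffOn ℝ S)
    (hf : ContDiffOn ℝ (k + 1 : ℕ) f (univ ×ˢ S)) (e : E) :
    ∃ g : E × ℝ → ℝ, ContDiffOn ℝ k g (univ ×ˢ S) ∧
      ∀ x, ∀ t ∈ S, HasLineDerivAt ℝ (fun y => f (y, t)) (g (x, t)) x e := by
  obtain ⟨g, hg, hd⟩ := exists_contDiffOn_dirDeriv hS hf (e, 0)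
  refine ⟨g, hg, fun x t ht => ?_⟩
  obtain ⟨L, hL, hLg⟩ := hd (x, t) ⟨mem_univ _, ht⟩
  rw [← hLg]
  have hline : HasDerivAt (fun s : ℝ => (x + s • e, t)) (e, 0) 0 := by
    have h1 : HasDerivAt (fun s : ℝ => x + s • e) e 0 := by
      simpa using ((hasDerivAt_id (0 : ℝ)).smul_const e).const_add x
    exact h1.prodMk (hasDerivAt_const 0 t)
  exact hL.comp_hasDerivAt_of_eq 0 hline (Eventually.of_forall fun s => ⟨mem_univ _, ht⟩) (by simp)

lemma HasLineDerivAt.hasDerivAt_add_smul {h : E → ℝ} {c : ℝ} {x e : E} {s : ℝ}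
    (hd : HasLineDerivAt ℝ h c (x + s • e) e) : HasDerivAt (fun r : ℝ => h (x + r • e)) c s := by
  have h1 : HasDerivAt (fun r : ℝ => h (x + s • e + r • e)) c (s - s) := by
    simpa [HasLineDerivAt] using hd
  have h2 := h1.comp_sub_const s s
  refine h2.congr_of_eventuallyEq (Eventually.of_forall fun r => ?_)
  simp [sub_smul]

end DirectionalDerivative

section TimeSet

variable {T : ℝ≥0∞}

lemma exists_Icc_subset_timeSet {t : ℝ} (ht : t ∈ timeSet T) :
    ∃ b, t < b ∧ Icc 0 b ⊆ timeSet T := by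
  obtain ⟨c, hc, hcT⟩ := exists_between ht.2
  have hc' : c ≠ ∞ := hcT.ne_top
  refine ⟨c.toReal, (ENNReal.ofReal_lt_iff_lt_toReal ht.1 hc').1 hc, fun s hs => ⟨hs.1, ?_⟩⟩
  exact (ENNReal.ofReal_le_of_le_toReal hs.2).trans_lt hcT

lemma timeSet_mem_nhds {t : ℝ} (ht : t ∈ timeSet T) (h0 : 0 < t) : timeSet T ∈ 𝓝 t := by
  obtain ⟨b, htb, hb⟩ := exists_Icc_subset_timeSet ht
  exact mem_of_superset (Icc_mem_nhds h0 htb) hb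

lemma timeSet_subset_closure_pos : timeSet T ⊆ closure (timeSet T ∩ Ioi 0) := by
  intro t ht
  obtain ⟨b, htb, hb⟩ := exists_Icc_subset_timeSet ht
  have hsub : Ioo t b ⊆ timeSet T ∩ Ioi 0 := fun s hs =>
    ⟨hb ⟨ht.1.trans hs.1.le, hs.2.le⟩, ht.1.trans_lt hs.1⟩
  refine closure_mono hsub ?_
  rw [closure_Ioo htb.ne]
  exact left_mem_Icc.2 htb.le

lemma uniqueDiffOn_timeSet : UniqueDiffOn ℝ (timeSet T) := by
  intro t ht
  obtain ⟨b, htb, hb⟩ := exists_Icc_subset_timeSet ht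
  exact (uniqueDiffOn_Icc (ht.1.trans_lt htb) t ⟨ht.1, htb.le⟩).mono hb

variable {E : Type*} [NormedAddCommGroup E] {f g : E × ℝ → ℝ} {R : ℝ}

lemma timeDeriv_eq_zero_of_norm_gt (hf : ∀ x, ∀ t ∈ timeSet T, t + R < ‖x‖ → f (x, t) = 0)
    (hd : ∀ x, ∀ t ∈ timeSet T, HasDerivWithinAt (fun s => f (x, s)) (g (x, t)) (timeSet T) t)
    (x : E) (t : ℝ) (ht : t ∈ timeSet T) (hx : t + R < ‖x‖) : g (x, t) = 0 := by
  have hev : (fun s => f (x, s)) =ᶠ[𝓝[timeSet T] t] fun _ => 0 := by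
    filter_upwards [self_mem_nhdsWithin,
      mem_nhdsWithin_of_mem_nhds (Iio_mem_nhds (lt_sub_iff_add_lt.2 hx))] with s hs hs'
    exact hf x s hs (lt_sub_iff_add_lt.1 hs')
  exact (uniqueDiffOn_timeSet t ht).eq_deriv _ (hd x t ht)
    ((hasDerivWithinAt_const t _ (0 : ℝ)).congr_of_eventuallyEq hev (hf x t ht hx))

/-- Differentiation under the integral sign for functions supported in a light cone. -/
lemma hasDerivWithinAt_integral_timeSet [NormedSpace ℝ E] [FiniteDimensional ℝ E]
    [MeasurableSpace E] [BorelSpace E] {μ : Measure E} [IsFiniteMeasureOnCompacts μ]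
    (hfc : ContinuousOn f (univ ×ˢ timeSet T)) (hgc : ContinuousOn g (univ ×ˢ timeSet T))
    (hf : ∀ x, ∀ t ∈ timeSet T, t + R < ‖x‖ → f (x, t) = 0)
    (hd : ∀ x, ∀ t ∈ timeSet T, HasDerivWithinAt (fun s => f (x, s)) (g (x, t)) (timeSet T) t)
    {t : ℝ} (ht : t ∈ timeSet T) :
    HasDerivWithinAt (fun s => ∫ x, f (x, s) ∂μ) (∫ x, g (x, t) ∂μ) (timeSet T) t := by
  obtain ⟨b, htb, hb⟩ := exists_Icc_subset_timeSet ht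
  have hg := timeDeriv_eq_zero_of_norm_gt hf hd
  have hsub : (univ : Set E) ×ˢ Icc 0 b ⊆ univ ×ˢ timeSet T := prod_mono_right hb
  have hout : ∀ x ∉ closedBall (0 : E) (b + R), ∀ s ∈ Icc 0 b, s + R < ‖x‖ := by
    intro x hx s hs
    have : b + R < ‖x‖ := by simpa using hx
    linarith [hs.2]
  refine (hasDerivWithinAt_integral_slice (isCompact_closedBall 0 (b + R)) (hfc.mono hsub)
    (hgc.mono hsub) (fun x s hs => ?_) (fun x hx s hs => hf x s (hb hs) (hout x hx s hs))
    (fun x hx s hs => hg x s (hb hs) (hout x hx s hs)) ⟨ht.1, htb⟩).mono fun s hs => hs.1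
  have hs' := hb (Ioo_subset_Icc_self hs)
  exact (hd x s hs').hasDerivAt (timeSet_mem_nhds hs' hs.1)

end TimeSet

/-- **(2.2'):** `F₀(t) = ∫ u(x,t) dx` is twice differentiable on `[0,T)` and
`F₀''(t) = ∫ |u(x,t)|^p dx`. -/
theorem F0_second_derivative
    (n : ℕ) (hn : 2 ≤ n) (p R : ℝ) (T : ℝ≥0∞)
    (hp : 1 < p) (hR : 0 < R) (hT : 0 < T)
    (u : EuclideanSpace ℝ (Fin n) → ℝ → ℝ) (u₀ u₁ : EuclideanSpace ℝ (Fin n) → ℝ)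
    (hdata_supp : ∀ x : EuclideanSpace ℝ (Fin n), R < ‖x‖ → u₀ x = 0 ∧ u₁ x = 0)
    (hreg : ContDiffOn ℝ 2 (fun q : EuclideanSpace ℝ (Fin n) × ℝ => u q.1 q.2)
      (Set.univ ×ˢ timeSet T))
    (heq : ∀ x, ∀ t ∈ timeSet T,
      lap n (fun y => u y t) x - iteratedDeriv 2 (u x) t + |u x t| ^ p = 0)
    (hinit₀ : ∀ x, u x 0 = u₀ x)
    (hinit₁ : ∀ x, deriv (u x) 0 = u₁ x)
    (hsupp : ∀ x, ∀ t ∈ timeSet T, t + R < ‖x‖ → u x t = 0 ∧ deriv (u x) t = 0) :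
    ∃ F₀' : ℝ → ℝ, ∀ t ∈ timeSet T,
      HasDerivWithinAt (fun s : ℝ => ∫ x, u x s) (F₀' t) (timeSet T) t ∧
      HasDerivWithinAt F₀' (∫ x, |u x t| ^ p) (timeSet T) t := by
  set S := timeSet T
  have hS : UniqueDiffOn ℝ S := uniqueDiffOn_timeSet
  set U : EuclideanSpace ℝ (Fin n) × ℝ → ℝ := fun q => u q.1 q.2
  have hU : ContDiffOn ℝ (1 + 1 : ℕ) U (univ ×ˢ S) := by exact_mod_cast hreg
  have hU0 : ∀ x, ∀ t ∈ S, t + R < ‖x‖ → U (x, t) = 0 := fun x t ht hx => (hsupp x t ht hx).1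
  obtain ⟨v, hv, hUv⟩ := exists_contDiffOn_timeDeriv hS hU
  obtain ⟨w, hw, hvw⟩ := exists_contDiffOn_timeDeriv (k := 0) hS hv
  choose g hg hUg using fun i : Fin n =>
    exists_contDiffOn_spaceDeriv hS hU (EuclideanSpace.single i (1 : ℝ))
  choose L hL hgL using fun i : Fin n =>
    exists_contDiffOn_spaceDeriv (k := 0) hS (hg i) (EuclideanSpace.single i (1 : ℝ))
  have hlap : ∀ x, ∀ t ∈ S, lap n (fun y => u y t) x = ∑ i, L i (x, t) := by
    intro x t ht
    refine Finset.sum_congr rfl fun i _ => iteratedDeriv_two_eq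
      (h' := fun s => g i (x + s • EuclideanSpace.single i (1 : ℝ), t))
      (Eventually.of_forall fun s => (hUg i _ t ht).hasDerivAt_add_smul) (hgL i x t ht)
  have hwave : ∀ x, EqOn (fun t => w (x, t)) (fun t => ∑ i, L i (x, t) + |u x t| ^ p) S := by
    intro x
    have hslice : MapsTo (fun t : ℝ => (x, t)) S (univ ×ˢ S) := fun t ht => ⟨mem_univ _, ht⟩
    have hcu : ContinuousOn (u x) S := hU.continuousOn.comp
      (f := fun t : ℝ => (x, t)) (by fun_prop) hslice
    refine EqOn.of_subset_closure (s := S ∩ Ioi 0) ?_ (hw.continuousOn.comp (by fun_prop) hslice)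
      ((continuousOn_finsetSum _ fun i _ => (hL i).continuousOn.comp (by fun_prop) hslice).add
        (hcu.abs.rpow_const fun t _ => Or.inr (by linarith)))
      inter_subset_left timeSet_subset_closure_pos
    rintro t ⟨ht, h0⟩
    have hn : S ∈ 𝓝 t := timeSet_mem_nhds ht h0
    have hdd : iteratedDeriv 2 (u x) t = w (x, t) := by
      refine iteratedDeriv_two_eq (h' := fun s => v (x, s)) ?_ ((hvw x t ht).hasDerivAt hn)
      filter_upwards [hn, Ioi_mem_nhds h0] with s hs hs0
      exact (hUv x s hs).hasDerivAt (timeSet_mem_nhds hs hs0)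
    have := heq x t ht
    rw [hlap x t ht, hdd] at this
    simp only
    linarith
  refine ⟨fun t => ∫ x, v (x, t), fun t ht => ⟨hasDerivWithinAt_integral_timeSet hU.continuousOn
    hv.continuousOn hU0 hUv ht, ?_⟩⟩
  have hkey : ∫ x, |u x t| ^ p = ∫ x, w (x, t) := by
    have hg0 : ∀ i x, t + R < ‖x‖ → g i (x, t) = 0 := fun i x hx =>
      hasLineDerivAt_eq_zero_of_norm_gt (fun y => hU0 y t ht) (hUg i x t ht) hx
    have hL0 : ∀ i x, t + R < ‖x‖ → L i (x, t) = 0 := fun i x hx =>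
      hasLineDerivAt_eq_zero_of_norm_gt (hg0 i) (hgL i x t ht) hx
    have hLc := fun i => continuous_slice (hL i).continuousOn ht
    have hK := isCompact_closedBall (0 : EuclideanSpace ℝ (Fin n)) (t + R)
    have hLi : ∀ i, Integrable fun x => L i (x, t) := fun i =>
      integrable_of_continuous_of_eq_zero hK (hLc i) fun x hx => hL0 i x (by simpa using hx)
    have hui : Integrable fun x => |u x t| ^ p := by
      refine integrable_of_continuous_of_eq_zero hK
        ((continuous_slice hU.continuousOn ht).abs.rpow_const fun x => Or.inr (by linarith))
        fun x hx => ?_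
      have hux : u x t = 0 := hU0 x t ht (by simpa using hx)
      simp [hux, Real.zero_rpow (by linarith : p ≠ 0)]
    have hLz : ∀ i, ∫ x, L i (x, t) = 0 := fun i =>
      integral_lineDeriv_eq_zero (continuous_slice (hg i).continuousOn ht) (hLc i) (hg0 i) (hL0 i)
        fun x => hgL i x t ht
    rw [integral_congr_ae (Eventually.of_forall fun x => hwave x ht),
      integral_add (integrable_finsetSum _ fun i _ => hLi i) hui,
      integral_finsetSum _ fun i _ => hLi i]
    simp [hLz]
  rw [hkey]
  exact hasDerivWithinAt_integral_timeSet hv.continuousOn hw.continuousOn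
    (timeDeriv_eq_zero_of_norm_gt hU0 hUv) hvw ht
end
end

section
/- If v : ℝⁿ → ℝ is radial, i.e. v(x) = g(|x|) for some function g, then for every unit vector w ∈ ℝⁿ and every ρ ∈ ℝ, the Radon transform satisfies R(v)(ρ) = c_n ∫_{|ρ|}^{∞} g(r) (r² − ρ²)^{(n−3)/2} r dr, where c_n is the surface measure of the unit sphere S^{n−2} in ℝ^{n−1}; in particular R(v)(ρ) is independent of the direction w. -/
open MeasureTheory Metric Set ENNReal Filter

noncomputable section

/-- The Radon transform of `v : ℝⁿ → ℝ` in direction `w` at level `ρ` : the integral of `v`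
over the hyperplane `{x | x·w = ρ}` with respect to `(n-1)`-dimensional Lebesgue measure. -/
def radon (n : ℕ) (v : EuclideanSpace ℝ (Fin n) → ℝ)
    (w : EuclideanSpace ℝ (Fin n)) (ρ : ℝ) : ℝ :=
  ∫ y : ((ℝ ∙ w)ᗮ : Submodule ℝ (EuclideanSpace ℝ (Fin n))),
    v (ρ • w + (y : EuclideanSpace ℝ (Fin n)))

/-- The substitution `r = √(ρ² + s²)`, which maps `(0, ∞)` onto `(|ρ|, ∞)`. -/
lemma image_sqrt_sq_add_sq_Ioi (ρ : ℝ) :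
    (fun s : ℝ => √(ρ ^ 2 + s ^ 2)) '' Ioi 0 = Ioi |ρ| := by
  ext r
  simp only [mem_image, mem_Ioi]
  constructor
  · rintro ⟨s, hs, rfl⟩
    apply Real.lt_sqrt_of_sq_lt
    rw [sq_abs]
    nlinarith
  · intro hr
    have hr0 : 0 ≤ r := (abs_nonneg ρ).trans hr.le
    have h : 0 < r ^ 2 - ρ ^ 2 := sub_pos.2 (sq_lt_sq.2 (by rwa [abs_of_nonneg hr0]))
    refine ⟨√(r ^ 2 - ρ ^ 2), Real.sqrt_pos.2 h, ?_⟩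
    rw [Real.sq_sqrt h.le, add_sub_cancel, Real.sqrt_sq hr0]

lemma injOn_sqrt_sq_add_sq_Ioi (ρ : ℝ) :
    InjOn (fun s : ℝ => √(ρ ^ 2 + s ^ 2)) (Ioi 0) := by
  intro s hs t ht hst
  have h : ρ ^ 2 + s ^ 2 = ρ ^ 2 + t ^ 2 :=
    (Real.sqrt_inj (by positivity) (by positivity)).1 hst
  exact (pow_left_inj₀ (le_of_lt hs) (le_of_lt ht) two_ne_zero).1 (by linarith)

lemma hasDerivAt_sqrt_sq_add_sq (ρ : ℝ) {s : ℝ} (hs : 0 < s) :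
    HasDerivAt (fun s : ℝ => √(ρ ^ 2 + s ^ 2)) (s / √(ρ ^ 2 + s ^ 2)) s := by
  have h : HasDerivAt (fun s : ℝ => ρ ^ 2 + s ^ 2) (2 * s) s := by
    simpa using (hasDerivAt_pow 2 s).const_add (ρ ^ 2)
  convert h.sqrt (by positivity) using 1
  rw [mul_div_mul_left _ _ two_ne_zero]

lemma integral_Ioi_abs_eq_integral_Ioi_zero (g : ℝ → ℝ) (ρ : ℝ) (m : ℕ) :
    ∫ r in Ioi |ρ|, g r * (r ^ 2 - ρ ^ 2) ^ ((m : ℝ) / 2) * r =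
      ∫ s in Ioi (0 : ℝ), s ^ (m + 1) • g (√(ρ ^ 2 + s ^ 2)) := by
  rw [← image_sqrt_sq_add_sq_Ioi ρ, integral_image_eq_integral_abs_deriv_smul measurableSet_Ioi
    (fun s hs => (hasDerivAt_sqrt_sq_add_sq ρ hs).hasDerivWithinAt) (injOn_sqrt_sq_add_sq_Ioi ρ)]
  refine setIntegral_congr_fun measurableSet_Ioi fun s hs => ?_
  have hs : 0 < s := hs
  have hpos : 0 < √(ρ ^ 2 + s ^ 2) := by positivity
  have hpow : (s ^ 2) ^ ((m : ℝ) / 2) = s ^ m := by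
    rw [← Real.rpow_natCast, ← Real.rpow_mul hs.le, ← Real.rpow_natCast]
    congr 1
    push_cast
    ring
  simp only [smul_eq_mul]
  rw [Real.sq_sqrt (by positivity), add_sub_cancel_left, hpow, abs_of_pos (by positivity)]
  field_simp
  ring

/-- A unit vector splits the norm of `ρ w + y`, for `y` orthogonal to `w`. -/
lemma norm_smul_add_orthogonal {E : Type*} [NormedAddCommGroup E] [InnerProductSpace ℝ E]
    {w : E} (hw : ‖w‖ = 1) (ρ : ℝ) (y : (ℝ ∙ w)ᗮ) :
    ‖ρ • w + (y : E)‖ = √(ρ ^ 2 + ‖y‖ ^ 2) := by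
  have hy : inner ℝ (ρ • w) (y : E) = 0 := by
    rw [inner_smul_left, Submodule.mem_orthogonal_singleton_iff_inner_right.1 y.2, mul_zero]
  rw [eq_comm, Real.sqrt_eq_iff_mul_self_eq (by positivity) (norm_nonneg _),
    norm_add_sq_eq_norm_sq_add_norm_sq_of_inner_eq_zero _ _ hy]
  simp [norm_smul, hw, sq]

lemma measureReal_ball_zero_eq_of_finrank_eq {E F : Type*}
    [NormedAddCommGroup E] [InnerProductSpace ℝ E] [FiniteDimensional ℝ E]
    [MeasurableSpace E] [BorelSpace E]
    [NormedAddCommGroup F] [InnerProductSpace ℝ F] [FiniteDimensional ℝ F]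
    [MeasurableSpace F] [BorelSpace F]
    (h : Module.finrank ℝ E = Module.finrank ℝ F) (r : ℝ) :
    (volume : Measure E).real (ball 0 r) = (volume : Measure F).real (ball 0 r) := by
  let e : E ≃ₗᵢ[ℝ] F := (stdOrthonormalBasis ℝ E).equiv (stdOrthonormalBasis ℝ F) (finCongr h)
  have := e.measurePreserving.measureReal_preimage (s := ball 0 r)
    measurableSet_ball.nullMeasurableSet
  rw [← this]
  congr 1
  ext x
  simp

/-- **(2.10):** if `v(x) = g(|x|)` is radial, then for every unit vector `w` and every
`ρ ∈ ℝ`, `R(v)(ρ) = c_n ∫_{|ρ|}^∞ g(r) (r² - ρ²)^{(n-3)/2} r dr`, where `c_n` is the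
surface measure of the unit sphere `S^{n-2} ⊆ ℝ^{n-1}`.  In particular `R(v)(ρ)` does not
depend on the direction `w`. -/
theorem radon_of_radial
    (n : ℕ) (hn : 3 ≤ n)
    (v : EuclideanSpace ℝ (Fin n) → ℝ) (hv : Integrable v volume)
    (g : ℝ → ℝ) (hrad : ∀ x, v x = g ‖x‖)
    (w : EuclideanSpace ℝ (Fin n)) (hw : ‖w‖ = 1) (ρ : ℝ) :
    radon n v w ρ =
      ((volume : Measure (EuclideanSpace ℝ (Fin (n - 1)))).toSphere Set.univ).toReal *
        ∫ r in Set.Ioi |ρ|, g r * (r ^ 2 - ρ ^ 2) ^ (((n : ℝ) - 3) / 2) * r := by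
  obtain ⟨m, rfl⟩ : ∃ m, n = m + 3 := ⟨n - 3, by omega⟩
  have hw0 : w ≠ 0 := norm_ne_zero_iff.1 (by rw [hw]; exact one_ne_zero)
  have hdim : Module.finrank ℝ (ℝ ∙ w)ᗮ = m + 2 := by
    have : Fact (Module.finrank ℝ (EuclideanSpace ℝ (Fin (m + 3))) = m + 2 + 1) := ⟨by simp⟩
    exact Submodule.finrank_orthogonal_span_singleton hw0
  have : Nontrivial (ℝ ∙ w)ᗮ := Module.nontrivial_of_finrank_pos (R := ℝ) (by omega)
  have hcast : ((m + 3 : ℕ) : ℝ) - 3 = m := by push_cast; ring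
  have hball := measureReal_ball_zero_eq_of_finrank_eq (E := (ℝ ∙ w)ᗮ)
    (F := EuclideanSpace ℝ (Fin (m + 3 - 1))) (by simp [hdim]) 1
  simp_rw [radon, hrad, norm_smul_add_orthogonal hw]
  rw [integral_fun_norm_addHaar volume (fun s => g (√(ρ ^ 2 + s ^ 2))), hdim, hball, hcast,
    integral_Ioi_abs_eq_integral_Ioi_zero, ← Measure.real, Measure.toSphere_real_apply_univ]
  simp [mul_assoc]
end
end

section
/- For every locally integrable f : ℝ → ℝ and every ρ ≤ t + R, |T(f)(ρ)| ≤ 2 M(|f|)(ρ), where M denotes the Hardy–Littlewood maximal function. -/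
open MeasureTheory Metric Set ENNReal Filter

noncomputable section

/-- The one-dimensional transform **T** of (2.16):
`T(f)(ρ) = |t - ρ + R|^{-(n-1)/2} ∫_ρ^{t+R} f(r) |r - ρ|^{(n-3)/2} dr`. -/
def Ttrans (n : ℕ) (t R : ℝ) (f : ℝ → ℝ) (ρ : ℝ) : ℝ :=
  |t - ρ + R| ^ (-(((n : ℝ) - 1) / 2)) * ∫ r in ρ..(t + R), f r * |r - ρ| ^ (((n : ℝ) - 3) / 2)

/-- The (centered) Hardy–Littlewood maximal function of `f : ℝ → ℝ`:
`M(f)(x) = sup_{r > 0} (2r)⁻¹ ∫_{x-r}^{x+r} |f(y)| dy`, valued in `ℝ≥0∞`. -/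
def maximalFn (f : ℝ → ℝ) (x : ℝ) : ℝ≥0∞ :=
  ⨆ r ∈ Set.Ioi (0 : ℝ), ENNReal.ofReal ((2 * r)⁻¹ * ∫ y in Set.Ioc (x - r) (x + r), |f y|)

/-- The transform `Ttrans` is bounded by twice the average of `|f|` over the interval of
radius `t + R - ρ` centred at `ρ`. -/
theorem abs_Ttrans_le_average {n : ℕ} (hn : 3 ≤ n) {t R ρ : ℝ} {f : ℝ → ℝ}
    (hf : LocallyIntegrable f volume) (hρ : ρ < t + R) :
    |Ttrans n t R f ρ| ≤ 2 * ((2 * (t + R - ρ))⁻¹ *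
      ∫ y in Set.Ioc (ρ - (t + R - ρ)) (ρ + (t + R - ρ)), |f y|) := by
  obtain ⟨a, ha⟩ : ∃ a, a = t + R - ρ := ⟨_, rfl⟩
  have ha0 : 0 < a := by linarith
  have hend : t + R = ρ + a := by linarith
  have hdist : t - ρ + R = a := by linarith
  have hexp : 0 ≤ ((n : ℝ) - 3) / 2 := by
    have : (3 : ℝ) ≤ n := by exact_mod_cast hn
    linarith
  have hint (x y : ℝ) : IntegrableOn (fun r => |f r|) (Set.Ioc x y) :=
    ((hf.integrableOn_isCompact isCompact_Icc).mono_set Set.Ioc_subset_Icc_self).abs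
  have hweight : |∫ r in ρ..(ρ + a), f r * |r - ρ| ^ (((n : ℝ) - 3) / 2)| ≤
      (∫ r in Set.Ioc ρ (ρ + a), |f r|) * a ^ (((n : ℝ) - 3) / 2) := by
    rw [intervalIntegral.integral_of_le (by linarith), ← integral_mul_const, ← Real.norm_eq_abs]
    refine norm_integral_le_of_norm_le ((hint _ _).mul_const _) ?_
    refine (ae_restrict_iff' measurableSet_Ioc).2 (Eventually.of_forall fun r hr => ?_)
    rw [Real.norm_eq_abs, abs_mul,
      abs_of_nonneg (show 0 ≤ |r - ρ| ^ (((n : ℝ) - 3) / 2) by positivity)]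
    gcongr
    rw [abs_of_pos (by linarith [hr.1])]
    linarith [hr.2]
  have hsymm : ∫ r in Set.Ioc ρ (ρ + a), |f r| ≤ ∫ r in Set.Ioc (ρ - a) (ρ + a), |f r| :=
    setIntegral_mono_set (hint _ _) (Eventually.of_forall fun _ => abs_nonneg _)
      (Set.Ioc_subset_Ioc_left (by linarith)).eventuallyLE
  have hpow : a ^ (-(((n : ℝ) - 1) / 2)) * a ^ (((n : ℝ) - 3) / 2) = a⁻¹ := by
    rw [← Real.rpow_add ha0, ← Real.rpow_neg_one]
    ring_nf
  rw [← ha, Ttrans, hdist, hend, abs_of_pos ha0, abs_mul, abs_of_nonneg (by positivity)]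
  calc a ^ (-(((n : ℝ) - 1) / 2)) * |∫ r in ρ..(ρ + a), f r * |r - ρ| ^ (((n : ℝ) - 3) / 2)|
      ≤ a ^ (-(((n : ℝ) - 1) / 2)) *
          ((∫ r in Set.Ioc (ρ - a) (ρ + a), |f r|) * a ^ (((n : ℝ) - 3) / 2)) := by
        gcongr
        exact hweight.trans (by gcongr)
    _ = a⁻¹ * ∫ r in Set.Ioc (ρ - a) (ρ + a), |f r| := by rw [← hpow]; ring
    _ = 2 * ((2 * a)⁻¹ * ∫ r in Set.Ioc (ρ - a) (ρ + a), |f r|) := by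
        rw [mul_inv]; ring

/-- **Pointwise bound by the maximal function:** for every locally integrable `f : ℝ → ℝ`
and every `ρ ≤ t + R`, `|T(f)(ρ)| ≤ 2 M(|f|)(ρ)`. -/
theorem Ttrans_le_maximal
    (n : ℕ) (hn : 4 ≤ n) (t R : ℝ) (ht : 0 < t) (hR : 0 < R)
    (f : ℝ → ℝ) (hf : LocallyIntegrable f volume) (ρ : ℝ) (hρ : ρ ≤ t + R) :
    ENNReal.ofReal |Ttrans n t R f ρ| ≤ 2 * maximalFn f ρ := by
  rcases hρ.eq_or_lt with rfl | hlt
  · simp [Ttrans]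
  · refine (ENNReal.ofReal_le_ofReal (abs_Ttrans_le_average (by omega) hf hlt)).trans ?_
    rw [ENNReal.ofReal_mul (by norm_num), ENNReal.ofReal_ofNat]
    gcongr
    exact le_iSup₂_of_le (t + R - ρ) (sub_pos.2 hlt) le_rfl
end
end

section
/- Let n ≥ 4 and 1 < p ≤ 2. There is a constant C > 0, independent of t, such that for all t ∈ [0,T), ∫_0^{t+R} [R(|u|)(ρ,t)]^p (t − ρ + R)^{−(n−1)p/2} ρ^{n−1−(n−1)p/2} dρ ≤ C ∫_{ℝⁿ} |u(x,t)|^p dx. -/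
open MeasureTheory Metric Set ENNReal Filter

noncomputable section

lemma lintegral_Ioo_rpow {s x : ℝ} (hs : -1 < s) (hx : 0 < x) :
    ∫⁻ y in Ioo 0 x, ENNReal.ofReal (y ^ s) = ENNReal.ofReal (x ^ (s + 1) / (s + 1)) := by
  have hint : IntegrableOn (fun y : ℝ => y ^ s) (Ioo 0 x) :=
    (intervalIntegral.integrableOn_Ioo_rpow_iff hx).2 hs
  rw [← ofReal_integral_eq_lintegral_ofReal hint
    (ae_restrict_of_forall_mem measurableSet_Ioo fun y hy => Real.rpow_nonneg hy.1.le s),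
    ← integral_Ioc_eq_integral_Ioo, ← intervalIntegral.integral_of_le hx.le,
    integral_rpow (Or.inl hs), Real.zero_rpow (by linarith), sub_zero]

lemma lintegral_Ioi_rpow {s y : ℝ} (hs : s < -1) (hy : 0 < y) :
    ∫⁻ x in Ioi y, ENNReal.ofReal (x ^ s) = ENNReal.ofReal (-y ^ (s + 1) / (s + 1)) := by
  rw [← ofReal_integral_eq_lintegral_ofReal (integrableOn_Ioi_rpow_of_lt hs hy)
    (ae_restrict_of_forall_mem measurableSet_Ioi fun x hx =>
      Real.rpow_nonneg (hy.trans hx).le s),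
    integral_Ioi_rpow_of_lt hs hy]

/-- The pointwise form of Hardy's inequality, from Hölder's inequality with power weights. -/
lemma hardy_pointwise {p : ℝ} (hp : 1 < p) {f : ℝ → ℝ≥0∞} (hf : Measurable f) {x : ℝ}
    (hx : 0 < x) :
    ENNReal.ofReal (x ^ (-p)) * (∫⁻ y in Ioo 0 x, f y) ^ p ≤
      ENNReal.ofReal ((1 - 1 / p) ^ (1 - p)) * (ENNReal.ofReal (x ^ (1 / p - 2)) *
        ∫⁻ y in Ioo 0 x, f y ^ p * ENNReal.ofReal (y ^ (1 - 1 / p))) := by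
  have hp0 : 0 < p := by linarith
  have hp1 : 1 / p < 1 := by rw [div_lt_one hp0]; exact hp
  have hp1' : 0 < 1 / p := by positivity
  set b : ℝ := 1 - 1 / p with hb
  have hb0 : 0 < b := by rw [hb]; linarith
  have hpq : p.HolderConjugate (1 / b) := by
    rw [Real.holderConjugate_iff]
    refine ⟨hp, ?_⟩
    rw [hb]; field_simp; ring
  set w : ℝ → ℝ≥0∞ := fun y => ENNReal.ofReal (y ^ (b / p)) with hw
  set w' : ℝ → ℝ≥0∞ := fun y => ENNReal.ofReal (y ^ (-(b / p))) with hw'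
  have hwm : Measurable w := by fun_prop
  have hwm' : Measurable w' := by fun_prop
  have h1 : ∫⁻ y in Ioo 0 x, f y = ∫⁻ y in Ioo 0 x, ((f * w) * w') y := by
    refine setLIntegral_congr_fun measurableSet_Ioo fun y hy => ?_
    simp only [Pi.mul_apply, hw, hw', mul_assoc]
    rw [← ENNReal.ofReal_mul (Real.rpow_nonneg hy.1.le _), ← Real.rpow_add hy.1]
    simp
  have h2 := ENNReal.lintegral_mul_le_Lp_mul_Lq (volume.restrict (Ioo 0 x)) hpq
    (hf.mul hwm).aemeasurable hwm'.aemeasurable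
  have h3 : ∫⁻ y in Ioo 0 x, (f * w) y ^ p =
      ∫⁻ y in Ioo 0 x, f y ^ p * ENNReal.ofReal (y ^ b) := by
    refine setLIntegral_congr_fun measurableSet_Ioo fun y hy => ?_
    simp only [Pi.mul_apply, hw]
    rw [ENNReal.mul_rpow_of_nonneg _ _ hp0.le,
      ENNReal.ofReal_rpow_of_pos (Real.rpow_pos_of_pos hy.1 _), ← Real.rpow_mul hy.1.le,
      div_mul_cancel₀ _ hp0.ne']
  have h4 : ∫⁻ y in Ioo 0 x, w' y ^ (1 / b) = ENNReal.ofReal (x ^ b / b) := by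
    rw [← show -(1 / p) + 1 = b by rw [hb]; ring, ← lintegral_Ioo_rpow (by linarith) hx]
    refine setLIntegral_congr_fun measurableSet_Ioo fun y hy => ?_
    simp only [hw']
    rw [ENNReal.ofReal_rpow_of_pos (Real.rpow_pos_of_pos hy.1 _), ← Real.rpow_mul hy.1.le]
    congr 2
    rw [show -(1 / p) + 1 = b by rw [hb]; ring]
    field_simp
  rw [← h1, h3, h4] at h2
  have hbp : b * p = p - 1 := by rw [hb]; field_simp
  calc ENNReal.ofReal (x ^ (-p)) * (∫⁻ y in Ioo 0 x, f y) ^ p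
      ≤ ENNReal.ofReal (x ^ (-p)) *
        ((∫⁻ y in Ioo 0 x, f y ^ p * ENNReal.ofReal (y ^ b)) ^ (1 / p) *
          ENNReal.ofReal (x ^ b / b) ^ (1 / (1 / b))) ^ p := by gcongr
    _ = (ENNReal.ofReal (x ^ (-p)) * ENNReal.ofReal ((x ^ b / b) ^ (p - 1))) *
        ∫⁻ y in Ioo 0 x, f y ^ p * ENNReal.ofReal (y ^ b) := by
      rw [ENNReal.mul_rpow_of_nonneg _ _ hp0.le, ← ENNReal.rpow_mul, ← ENNReal.rpow_mul,
        one_div_mul_cancel hp0.ne', ENNReal.rpow_one, one_div_one_div, hbp,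
        ENNReal.ofReal_rpow_of_pos (by positivity)]
      ring
    _ = _ := by
      rw [← mul_assoc, ← ENNReal.ofReal_mul (by positivity), ← ENNReal.ofReal_mul (by positivity)]
      congr 2
      rw [Real.div_rpow (by positivity) hb0.le, ← Real.rpow_mul hx.le, div_eq_mul_inv,
        ← Real.rpow_neg hb0.le, ← mul_assoc, ← Real.rpow_add hx, mul_comm]
      congr 2
      · ring
      · rw [hb]; field_simp; ring

/-- **Hardy's inequality** on the half line. -/
lemma hardy_lintegral {p : ℝ} (hp : 1 < p) {f : ℝ → ℝ≥0∞} (hf : Measurable f) :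
    ∫⁻ x in Ioi 0, ENNReal.ofReal (x ^ (-p)) * (∫⁻ y in Ioo 0 x, f y) ^ p ≤
      ENNReal.ofReal ((1 - 1 / p) ^ (-p)) * ∫⁻ y in Ioi 0, f y ^ p := by
  have hp0 : 0 < p := by linarith
  have hp1 : 1 / p < 1 := by rw [div_lt_one hp0]; exact hp
  have hb0 : 0 < 1 - 1 / p := by linarith
  set F : ℝ → ℝ≥0∞ := fun y => f y ^ p * ENNReal.ofReal (y ^ (1 - 1 / p)) with hF
  have hFm : Measurable F := by fun_prop
  calc ∫⁻ x in Ioi 0, ENNReal.ofReal (x ^ (-p)) * (∫⁻ y in Ioo 0 x, f y) ^ p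
      ≤ ∫⁻ x in Ioi 0, ENNReal.ofReal ((1 - 1 / p) ^ (1 - p)) *
          (ENNReal.ofReal (x ^ (1 / p - 2)) * ∫⁻ y in Ioo 0 x, F y) :=
        setLIntegral_mono' measurableSet_Ioi fun x hx => hardy_pointwise hp hf hx
    _ = ENNReal.ofReal ((1 - 1 / p) ^ (1 - p)) * ∫⁻ x in Ioi 0,
          (ENNReal.ofReal (x ^ (1 / p - 2)) * ∫⁻ y in Ioo 0 x, F y) :=
        lintegral_const_mul' _ _ ENNReal.ofReal_ne_top
    _ = ENNReal.ofReal ((1 - 1 / p) ^ (1 - p)) * ∫⁻ x in Ioi (0 : ℝ), ∫⁻ y in Ioi (0 : ℝ),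
          {z : ℝ × ℝ | z.2 < z.1}.indicator
            (fun z => ENNReal.ofReal (z.1 ^ (1 / p - 2)) * F z.2) (x, y) := by
        congr 1
        refine lintegral_congr fun x => ?_
        rw [← lintegral_const_mul' _ _ ENNReal.ofReal_ne_top,
          ← Ioi_inter_Iio, inter_comm, ← Measure.restrict_restrict measurableSet_Iio,
          ← lintegral_indicator measurableSet_Iio]
        rfl
    _ = ENNReal.ofReal ((1 - 1 / p) ^ (1 - p)) * ∫⁻ y in Ioi (0 : ℝ), ∫⁻ x in Ioi (0 : ℝ),
          {z : ℝ × ℝ | z.2 < z.1}.indicator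
            (fun z => ENNReal.ofReal (z.1 ^ (1 / p - 2)) * F z.2) (x, y) := by
        rw [lintegral_lintegral_swap]
        refine Measurable.aemeasurable (Measurable.indicator (by fun_prop) ?_)
        exact measurableSet_lt measurable_snd measurable_fst
    _ = ENNReal.ofReal ((1 - 1 / p) ^ (1 - p)) * ∫⁻ y in Ioi (0 : ℝ),
          ENNReal.ofReal ((1 - 1 / p)⁻¹) * f y ^ p := by
        congr 1
        refine setLIntegral_congr_fun measurableSet_Ioi fun y hy => ?_
        have hy : 0 < y := hy
        have : ∀ x, {z : ℝ × ℝ | z.2 < z.1}.indicator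
            (fun z => ENNReal.ofReal (z.1 ^ (1 / p - 2)) * F z.2) (x, y) =
            (Ioi y).indicator (fun x => ENNReal.ofReal (x ^ (1 / p - 2)) * F y) x := fun x => rfl
        simp only [this]
        rw [lintegral_indicator measurableSet_Ioi, Measure.restrict_restrict measurableSet_Ioi,
          inter_eq_left.2 (Ioi_subset_Ioi hy.le),
          lintegral_mul_const _ (by fun_prop), lintegral_Ioi_rpow (by linarith) hy, hF]
        simp only
        rw [mul_comm (f y ^ p), ← mul_assoc, ← ENNReal.ofReal_mul]
        · congr 2
          rw [show 1 / p - 2 + 1 = -(1 - 1 / p) by ring, neg_div_neg_eq, div_mul_eq_mul_div,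
            ← Real.rpow_add hy]
          simp
        · rw [show 1 / p - 2 + 1 = -(1 - 1 / p) by ring, neg_div_neg_eq]
          positivity
    _ = _ := by
        rw [lintegral_const_mul' _ _ ENNReal.ofReal_ne_top, ← mul_assoc,
          ← ENNReal.ofReal_mul (by positivity)]
        congr 2
        rw [← Real.rpow_neg_one, ← Real.rpow_add hb0]
        congr 1; ring

/-- Hardy's inequality for averages over the interval between a point and a right endpoint. -/
lemma hardy_lintegral_right {p : ℝ} (hp : 1 < p) {f : ℝ → ℝ≥0∞} (hf : Measurable f) (A : ℝ) :
    ∫⁻ x in Iio A, ENNReal.ofReal ((A - x) ^ (-p)) * (∫⁻ y in Ioo x A, f y) ^ p ≤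
      ENNReal.ofReal ((1 - 1 / p) ^ (-p)) * ∫⁻ y in Iio A, f y ^ p := by
  have h := hardy_lintegral hp (f := fun y => f (A - y)) (by fun_prop)
  have key : ∀ (k : ℝ → ℝ≥0∞) (s : Set ℝ), MeasurableSet s →
      ∫⁻ x in (fun x => A - x) ⁻¹' s, k (A - x) = ∫⁻ x in s, k x := by
    intro k s hs
    rw [← lintegral_indicator hs, ← lintegral_indicator (hs.preimage (by fun_prop)),
      ← lintegral_sub_left_eq_self (s.indicator k) A]
    rfl
  have e1 : Ioi (0 : ℝ) = (fun x => A - x) ⁻¹' Iio A := by ext; simp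
  have e2 : ∀ x, Ioo 0 x = (fun y => A - y) ⁻¹' Ioo (A - x) A := by
    intro x; ext; simp [and_comm]
  rw [← key _ (Iio A) measurableSet_Iio, ← key _ (Iio A) measurableSet_Iio, ← e1]
  convert h using 5 with x
  · rw [_root_.sub_sub_cancel]
  · rw [e2, key f _ measurableSet_Ioo]

/-- The surface area of the unit sphere in a Euclidean space of dimension `m`. -/
def sphereArea (m : ℕ) : ℝ := m * (volume : Measure (EuclideanSpace ℝ (Fin m))).real (ball 0 1)

lemma sphereArea_pos {m : ℕ} (hm : 0 < m) : 0 < sphereArea m := by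
  have : (0 : ℝ) < m := by exact_mod_cast hm
  exact _root_.mul_pos this
    (ENNReal.toReal_pos (measure_ball_pos _ _ one_pos).ne' measure_ball_lt_top.ne)

lemma integral_radial {E : Type*} [NormedAddCommGroup E] [InnerProductSpace ℝ E]
    [FiniteDimensional ℝ E] [MeasurableSpace E] [BorelSpace E] {m : ℕ}
    (hm : 0 < m) (hE : Module.finrank ℝ E = m) (G : ℝ → ℝ) :
    ∫ x : E, G ‖x‖ = sphereArea m * ∫ s in Ioi (0 : ℝ), s ^ (m - 1) * G s := by
  have : Nontrivial E := Module.nontrivial_of_finrank_pos (R := ℝ) (by omega)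
  have : Nonempty (Fin m) := ⟨⟨0, hm⟩⟩
  rw [integral_fun_norm_addHaar volume G, hE, sphereArea, measureReal_def, measureReal_def,
    InnerProductSpace.volume_ball, EuclideanSpace.volume_ball, hE, Fintype.card_fin]
  simp [mul_assoc]

lemma radon_radial {n : ℕ} (hn : 2 ≤ n) (G : ℝ → ℝ) {w : EuclideanSpace ℝ (Fin n)}
    (hw : ‖w‖ = 1) (ρ : ℝ) :
    radon n (fun x => G ‖x‖) w ρ =
      sphereArea (n - 1) * ∫ s in Ioi (0 : ℝ), s ^ (n - 2) * G √(ρ ^ 2 + s ^ 2) := by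
  have hw0 : w ≠ 0 := by
    rintro rfl
    simp at hw
  have : Fact (Module.finrank ℝ (EuclideanSpace ℝ (Fin n)) = (n - 1) + 1) :=
    ⟨by rw [finrank_euclideanSpace_fin]; omega⟩
  have hd : Module.finrank ℝ ((ℝ ∙ w)ᗮ : Submodule ℝ (EuclideanSpace ℝ (Fin n))) = n - 1 :=
    Submodule.finrank_orthogonal_span_singleton hw0
  rw [show n - 2 = n - 1 - 1 by omega,
    ← integral_radial (by omega) hd (fun s => G √(ρ ^ 2 + s ^ 2)), radon]
  refine integral_congr_ae (Eventually.of_forall fun y => ?_)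
  have hy : inner ℝ w (y : EuclideanSpace ℝ (Fin n)) = 0 :=
    (Submodule.mem_orthogonal_singleton_iff_inner_right.1 y.2)
  have h := norm_add_sq_eq_norm_sq_add_norm_sq_of_inner_eq_zero (ρ • w)
    (y : EuclideanSpace ℝ (Fin n)) (by rw [inner_smul_left, hy, mul_zero])
  simp only
  congr 1
  rw [eq_comm, Real.sqrt_eq_iff_mul_self_eq (by positivity) (norm_nonneg _), h, norm_smul, hw,
    Submodule.coe_norm, Real.norm_eq_abs, mul_one, abs_mul_abs_self]
  ring

/-- The polar form of the Radon transform of a radial function supported in a ball of radius `A`,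
estimated through `r² - ρ² ≤ 2 r (A - ρ)`. -/
lemma radon_radial_le {n : ℕ} (hn : 3 ≤ n) {G : ℝ → ℝ} (hG : Continuous G) (hG0 : ∀ r, 0 ≤ G r)
    {A : ℝ} (hA : ∀ r, A < r → G r = 0) {w : EuclideanSpace ℝ (Fin n)} (hw : ‖w‖ = 1)
    {ρ : ℝ} (hρ : 0 < ρ) (hρA : ρ < A) :
    radon n (fun x => G ‖x‖) w ρ ≤
      sphereArea (n - 1) * 2 ^ (((n : ℝ) - 3) / 2) * (A - ρ) ^ (((n : ℝ) - 3) / 2) *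
        ∫ r in ρ..A, r ^ (((n : ℝ) - 1) / 2) * G r := by
  rw [radon_radial (by omega) G hw, mul_assoc, mul_assoc]
  refine mul_le_mul_of_nonneg_left ?_ (sphereArea_pos (by omega)).le
  set k : ℝ := ((n : ℝ) - 3) / 2 with hk
  have hk0 : 0 ≤ k := by
    have : (3 : ℝ) ≤ n := by exact_mod_cast hn
    rw [hk]; linarith
  set B : ℝ := √(A ^ 2 - ρ ^ 2) with hB
  have hB0 : 0 ≤ B := Real.sqrt_nonneg _
  have hBsq : B ^ 2 = A ^ 2 - ρ ^ 2 := Real.sq_sqrt (by nlinarith)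
  have hpos : ∀ s : ℝ, 0 < ρ ^ 2 + s ^ 2 := fun s => by positivity
  set r : ℝ → ℝ := fun s => √(ρ ^ 2 + s ^ 2) with hr
  have hrpos : ∀ s, 0 < r s := fun s => Real.sqrt_pos.2 (hpos s)
  have hrsq : ∀ s, r s ^ 2 = ρ ^ 2 + s ^ 2 := fun s => Real.sq_sqrt (hpos s).le
  have hrc : Continuous r := by fun_prop
  set φ : ℝ → ℝ := fun x => ((A - ρ) * (2 * x)) ^ k * x * G x with hφ
  have hφc : Continuous φ := by
    have : Continuous fun x : ℝ => ((A - ρ) * (2 * x)) ^ k :=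
      (by fun_prop : Continuous fun x : ℝ => (A - ρ) * (2 * x)).rpow_const fun _ => Or.inr hk0
    fun_prop
  have hderiv : ∀ s, HasDerivAt r (s / r s) s := fun s => by
    have h := ((hasDerivAt_pow 2 s).const_add (ρ ^ 2)).sqrt (hpos s).ne'
    convert h using 1
    simp only [hr]
    field_simp
    simp [mul_comm]
  have hdc : Continuous fun s => s / r s := continuous_id.div hrc fun s => (hrpos s).ne'
  have hsubst : ∫ s in (0 : ℝ)..B, (φ ∘ r) s * (s / r s) = ∫ x in ρ..A, φ x := by
    rw [intervalIntegral.integral_comp_mul_deriv' (fun s _ => hderiv s) hdc.continuousOn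
      hφc.continuousOn]
    congr 1
    · simp [hr, Real.sqrt_sq hρ.le]
    · simp only [hr]
      rw [hBsq, add_sub_cancel, Real.sqrt_sq (by linarith)]
  calc ∫ s in Ioi (0 : ℝ), s ^ (n - 2) * G √(ρ ^ 2 + s ^ 2)
      = ∫ s in (0 : ℝ)..B, s ^ (n - 2) * G (r s) := by
        rw [intervalIntegral.integral_of_le hB0]
        refine setIntegral_eq_of_subset_of_forall_sdiff_eq_zero measurableSet_Ioi
          Ioc_subset_Ioi_self fun s hs => ?_
        have hs0 : 0 < s := hs.1
        have hsB : B < s := by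
          by_contra! h
          exact hs.2 ⟨hs0, h⟩
        rw [hA _ (Real.lt_sqrt_of_sq_lt (by nlinarith)), mul_zero]
    _ ≤ ∫ s in (0 : ℝ)..B, (φ ∘ r) s * (s / r s) := by
        refine intervalIntegral.integral_mono_on hB0 (Continuous.intervalIntegrable (by fun_prop) _ _)
          (Continuous.intervalIntegrable (by fun_prop) _ _) fun s hs => ?_
        have hrA : r s ≤ A := by
          refine Real.sqrt_le_iff.2 ⟨by linarith, ?_⟩
          nlinarith [hs.1, hs.2]
        have hρr : ρ ≤ r s := Real.le_sqrt_of_sq_le (by nlinarith)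
        have hs2 : s ^ 2 ≤ (A - ρ) * (2 * r s) := by nlinarith [hrsq s]
        have hsk : s ^ (n - 3) ≤ ((A - ρ) * (2 * r s)) ^ k := by
          calc s ^ (n - 3) = (s ^ 2) ^ k := by
                rw [← Real.rpow_natCast s 2, ← Real.rpow_mul hs.1, hk, ← Real.rpow_natCast]
                congr 1
                push_cast [hn]
                ring
            _ ≤ _ := Real.rpow_le_rpow (sq_nonneg s) hs2 hk0
        have : (φ ∘ r) s * (s / r s) = ((A - ρ) * (2 * r s)) ^ k * s * G (r s) := by
          simp only [hφ, Function.comp]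
          have := (hrpos s).ne'
          field_simp
        rw [this, show n - 2 = n - 3 + 1 by omega, pow_succ]
        exact mul_le_mul_of_nonneg_right (mul_le_mul_of_nonneg_right hsk hs.1) (hG0 _)
    _ = ∫ x in ρ..A, φ x := hsubst
    _ = 2 ^ k * ((A - ρ) ^ k * ∫ x in ρ..A, x ^ (((n : ℝ) - 1) / 2) * G x) := by
        rw [← mul_assoc, ← intervalIntegral.integral_const_mul]
        refine intervalIntegral.integral_congr fun x hx => ?_
        rw [uIcc_of_le hρA.le] at hx
        have hx0 : 0 < x := hρ.trans_le hx.1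
        simp only [hφ]
        rw [Real.mul_rpow (by linarith) (by positivity), Real.mul_rpow (by norm_num) hx0.le,
          show ((n : ℝ) - 1) / 2 = k + 1 by rw [hk]; ring, Real.rpow_add hx0, Real.rpow_one]
        ring

/-- The weighted `L^p` bound for the Radon transform of a radial function supported in a ball. -/
lemma setIntegral_radon_radial_le {n : ℕ} (hn : 3 ≤ n) {p : ℝ} (hp : 1 < p) (hp2 : p ≤ 2)
    {G : ℝ → ℝ} (hG : Continuous G) (hG0 : ∀ r, 0 ≤ G r) {A : ℝ} (hA : ∀ r, A < r → G r = 0)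
    {w : EuclideanSpace ℝ (Fin n)} (hw : ‖w‖ = 1) :
    ∫ ρ in Ioc 0 A, radon n (fun x => G ‖x‖) w ρ ^ p * (A - ρ) ^ (-(((n : ℝ) - 1) * p / 2)) *
        ρ ^ ((n : ℝ) - 1 - ((n : ℝ) - 1) * p / 2) ≤
      (sphereArea (n - 1) * 2 ^ (((n : ℝ) - 3) / 2)) ^ p * (1 - 1 / p) ^ (-p) / sphereArea n *
        ∫ x : EuclideanSpace ℝ (Fin n), G ‖x‖ ^ p := by
  have hp0 : 0 < p := by linarith
  have hb0 : 0 < 1 - 1 / p := by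
    have : 1 / p < 1 := by rwa [div_lt_one hp0]
    linarith
  have hn3 : (3 : ℝ) ≤ n := by exact_mod_cast hn
  have hS : 0 < sphereArea n := sphereArea_pos (by omega)
  have hS' : 0 < sphereArea (n - 1) := sphereArea_pos (by omega)
  set K : ℝ := sphereArea (n - 1) * 2 ^ (((n : ℝ) - 3) / 2) with hK
  have hK0 : 0 < K := by positivity
  set a : ℝ := ((n : ℝ) - 1) / p with ha
  have ha0 : 0 ≤ a := div_nonneg (by linarith) hp0.le
  set h : ℝ → ℝ := fun r => r ^ a * G r with hh
  have hhc : Continuous h := (Real.continuous_rpow_const ha0).mul hG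
  have hh0 : ∀ r, 0 < r → 0 ≤ h r := fun r hr => mul_nonneg (Real.rpow_nonneg hr.le _) (hG0 r)
  set f : ℝ → ℝ≥0∞ := (Ioi 0).indicator fun r => ENNReal.ofReal (h r) with hf
  have hfm : Measurable f := Measurable.indicator (by fun_prop) measurableSet_Ioi
  have hpt : ∀ ρ ∈ Ioo 0 A, radon n (fun x => G ‖x‖) w ρ ^ p *
      (A - ρ) ^ (-(((n : ℝ) - 1) * p / 2)) * ρ ^ ((n : ℝ) - 1 - ((n : ℝ) - 1) * p / 2) ≤
      K ^ p * ((A - ρ) ^ (-p) * (∫ r in ρ..A, h r) ^ p) := by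
    rintro ρ ⟨hρ, hρA⟩
    have hAρ : 0 < A - ρ := by linarith
    set I : ℝ := ∫ r in ρ..A, r ^ (((n : ℝ) - 1) / 2) * G r with hI
    have hI0 : 0 ≤ I := intervalIntegral.integral_nonneg hρA.le fun r hr =>
      mul_nonneg (Real.rpow_nonneg (hρ.le.trans hr.1) _) (hG0 r)
    set e : ℝ := a - ((n : ℝ) - 1) / 2 with he
    have he0 : 0 ≤ e := by
      rw [he, ha, sub_nonneg]
      exact div_le_div_of_nonneg_left (by linarith) hp0 hp2
    have hIJ : ρ ^ e * I ≤ ∫ r in ρ..A, h r := by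
      rw [hI, ← intervalIntegral.integral_const_mul]
      refine intervalIntegral.integral_mono_on hρA.le
        (Continuous.intervalIntegrable (continuous_const.mul
          ((Real.continuous_rpow_const (by linarith)).mul hG)) _ _)
        (hhc.intervalIntegrable _ _) fun r hr => ?_
      have hr0 : 0 < r := hρ.trans_le hr.1
      have : h r = r ^ e * (r ^ (((n : ℝ) - 1) / 2) * G r) := by
        rw [← mul_assoc, ← Real.rpow_add hr0, he, sub_add_cancel]
      rw [this]
      exact mul_le_mul_of_nonneg_right (Real.rpow_le_rpow hρ.le hr.1 he0)
        (mul_nonneg (Real.rpow_nonneg hr0.le _) (hG0 r))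
    have hrad0 : 0 ≤ radon n (fun x => G ‖x‖) w ρ := integral_nonneg fun y => hG0 _
    have hrad := radon_radial_le hn hG hG0 hA hw hρ hρA
    rw [← hK, ← hI] at hrad
    calc _ ≤ (K * (A - ρ) ^ (((n : ℝ) - 3) / 2) * I) ^ p *
          (A - ρ) ^ (-(((n : ℝ) - 1) * p / 2)) * ρ ^ ((n : ℝ) - 1 - ((n : ℝ) - 1) * p / 2) := by
          gcongr
      _ = K ^ p * ((A - ρ) ^ (-p) * (ρ ^ e * I) ^ p) := by
          rw [Real.mul_rpow (by positivity) hI0, Real.mul_rpow hK0.le (by positivity),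
            Real.mul_rpow (by positivity) hI0, ← Real.rpow_mul hAρ.le, ← Real.rpow_mul hρ.le,
            show -p = ((n : ℝ) - 3) / 2 * p + -(((n : ℝ) - 1) * p / 2) by ring,
            Real.rpow_add hAρ, show e * p = (n : ℝ) - 1 - ((n : ℝ) - 1) * p / 2 by
              rw [he, ha]; field_simp]
          ring
      _ ≤ _ := by gcongr
  have hJ : ∀ ρ ∈ Ioo 0 A, ENNReal.ofReal ((A - ρ) ^ (-p) * (∫ r in ρ..A, h r) ^ p) =
      ENNReal.ofReal ((A - ρ) ^ (-p)) * (∫⁻ r in Ioo ρ A, f r) ^ p := by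
    rintro ρ ⟨hρ, hρA⟩
    have hAρ : 0 < A - ρ := by linarith
    have h0 : ∀ r ∈ Ioo ρ A, 0 ≤ h r := fun r hr => hh0 r (hρ.trans hr.1)
    rw [intervalIntegral.integral_of_le hρA.le, integral_Ioc_eq_integral_Ioo,
      ENNReal.ofReal_mul (by positivity),
      ← ENNReal.ofReal_rpow_of_nonneg (setIntegral_nonneg measurableSet_Ioo h0) hp0.le,
      ofReal_integral_eq_lintegral_ofReal
        (hhc.integrableOn_Icc.mono_set Ioo_subset_Icc_self)
        (ae_restrict_of_forall_mem measurableSet_Ioo h0)]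
    congr 2
    refine setLIntegral_congr_fun measurableSet_Ioo fun r hr => ?_
    rw [hf, indicator_of_mem (show r ∈ Ioi 0 from hρ.trans hr.1)]
  set M : ℝ := ∫ r in Ioo 0 A, r ^ (n - 1) * G r ^ p with hM
  have hGpc : Continuous fun r => r ^ (n - 1) * G r ^ p :=
    (continuous_pow _).mul (hG.rpow_const fun _ => Or.inr hp0.le)
  have hM0 : 0 ≤ M := setIntegral_nonneg measurableSet_Ioo fun r hr =>
    mul_nonneg (pow_nonneg hr.1.le _) (Real.rpow_nonneg (hG0 r) _)
  have hfM : ∫⁻ r in Iio A, f r ^ p = ENNReal.ofReal M := by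
    rw [hM, ofReal_integral_eq_lintegral_ofReal
      (hGpc.integrableOn_Icc.mono_set Ioo_subset_Icc_self)
      (ae_restrict_of_forall_mem measurableSet_Ioo fun r hr =>
        mul_nonneg (pow_nonneg hr.1.le _) (Real.rpow_nonneg (hG0 r) _)),
      ← Ioi_inter_Iio, ← Measure.restrict_restrict measurableSet_Ioi,
      ← lintegral_indicator measurableSet_Ioi]
    refine lintegral_congr fun r => ?_
    by_cases hr : r ∈ Ioi (0 : ℝ)
    · have hr0 : 0 < r := hr
      rw [hf, indicator_of_mem hr, indicator_of_mem hr,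
        ENNReal.ofReal_rpow_of_nonneg (hh0 r hr) hp0.le, hh]
      simp only
      rw [Real.mul_rpow (by positivity) (hG0 r), ← Real.rpow_mul hr0.le, ha,
        div_mul_cancel₀ _ hp0.ne', ← Real.rpow_natCast, Nat.cast_sub (by omega), Nat.cast_one]
    · rw [hf, indicator_of_notMem hr, indicator_of_notMem hr, ENNReal.zero_rpow_of_pos hp0]
  have hRM : ∫ x : EuclideanSpace ℝ (Fin n), G ‖x‖ ^ p = sphereArea n * M := by
    rw [integral_radial (by omega) finrank_euclideanSpace_fin (fun r => G r ^ p), hM,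
      ← integral_Ioc_eq_integral_Ioo]
    congr 1
    refine setIntegral_eq_of_subset_of_forall_sdiff_eq_zero measurableSet_Ioi
      Ioc_subset_Ioi_self fun r hr => ?_
    have hrA : A < r := by
      by_contra! h
      exact hr.2 ⟨hr.1, h⟩
    rw [hA r hrA, Real.zero_rpow hp0.ne', mul_zero]
  have hrhs : K ^ p * (1 - 1 / p) ^ (-p) / sphereArea n * (sphereArea n * M) =
      K ^ p * (1 - 1 / p) ^ (-p) * M := by
    field_simp
  rw [hRM, hrhs, integral_Ioc_eq_integral_Ioo]
  have hrhs0 : 0 ≤ K ^ p * (1 - 1 / p) ^ (-p) * M := by positivity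
  set Φ : ℝ → ℝ := fun ρ => radon n (fun x => G ‖x‖) w ρ ^ p *
      (A - ρ) ^ (-(((n : ℝ) - 1) * p / 2)) * ρ ^ ((n : ℝ) - 1 - ((n : ℝ) - 1) * p / 2)
  by_cases hint : IntegrableOn Φ (Ioo 0 A)
  swap
  · rw [integral_undef hint]
    exact hrhs0
  have hΦ0 : ∀ ρ ∈ Ioo 0 A, 0 ≤ Φ ρ := fun ρ hρ =>
    mul_nonneg (mul_nonneg (Real.rpow_nonneg (integral_nonneg fun y => hG0 _) _)
      (Real.rpow_nonneg (by linarith [hρ.2]) _)) (Real.rpow_nonneg hρ.1.le _)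
  rw [← ENNReal.ofReal_le_ofReal_iff hrhs0, ofReal_integral_eq_lintegral_ofReal hint
    (ae_restrict_of_forall_mem measurableSet_Ioo hΦ0)]
  calc ∫⁻ ρ in Ioo 0 A, ENNReal.ofReal (Φ ρ)
      ≤ ∫⁻ ρ in Ioo 0 A, ENNReal.ofReal (K ^ p) *
          (ENNReal.ofReal ((A - ρ) ^ (-p)) * (∫⁻ r in Ioo ρ A, f r) ^ p) := by
        refine setLIntegral_mono' measurableSet_Ioo fun ρ hρ => ?_
        rw [← hJ ρ hρ, ← ENNReal.ofReal_mul (by positivity)]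
        exact ENNReal.ofReal_le_ofReal (hpt ρ hρ)
    _ = ENNReal.ofReal (K ^ p) * ∫⁻ ρ in Ioo 0 A,
          ENNReal.ofReal ((A - ρ) ^ (-p)) * (∫⁻ r in Ioo ρ A, f r) ^ p :=
        lintegral_const_mul' _ _ ENNReal.ofReal_ne_top
    _ ≤ ENNReal.ofReal (K ^ p) * ∫⁻ ρ in Iio A,
          ENNReal.ofReal ((A - ρ) ^ (-p)) * (∫⁻ r in Ioo ρ A, f r) ^ p := by
        gcongr
        exact Ioo_subset_Iio_self
    _ ≤ ENNReal.ofReal (K ^ p) *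
          (ENNReal.ofReal ((1 - 1 / p) ^ (-p)) * ∫⁻ r in Iio A, f r ^ p) := by
        gcongr
        exact hardy_lintegral_right hp hfm A
    _ = ENNReal.ofReal (K ^ p * (1 - 1 / p) ^ (-p) * M) := by
        rw [hfM, ENNReal.ofReal_mul (by positivity), ENNReal.ofReal_mul (by positivity), mul_assoc]

/-- **(2.21):** let `n ≥ 4` and `1 < p ≤ 2`.  There is `C > 0`, independent of `t`, with
`∫₀^{t+R} [R(|u|)(ρ,t)]^p (t-ρ+R)^{-(n-1)p/2} ρ^{n-1-(n-1)p/2} dρ ≤ C ∫ |u(x,t)|^p dx`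
for all `t ∈ [0,T)`. -/
theorem radon_weighted_Lp_bound
    (n : ℕ) (hn : 4 ≤ n) (p R : ℝ) (T : ℝ≥0∞)
    (hp : 1 < p) (hp2 : p ≤ 2) (hR : 0 < R) (hT : 0 < T)
    (u : EuclideanSpace ℝ (Fin n) → ℝ → ℝ)
    (g : ℝ → ℝ → ℝ) (hradial : ∀ x t, u x t = g ‖x‖ t)
    (hreg : ContDiffOn ℝ 2 (fun q : EuclideanSpace ℝ (Fin n) × ℝ => u q.1 q.2)
      (Set.univ ×ˢ timeSet T))
    (heq : ∀ x, ∀ t ∈ timeSet T,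
      lap n (fun y => u y t) x - iteratedDeriv 2 (u x) t + |u x t| ^ p = 0)
    (hsupp : ∀ x, ∀ t ∈ timeSet T, t + R < ‖x‖ → u x t = 0) :
    ∃ C : ℝ, 0 < C ∧
      ∀ w : EuclideanSpace ℝ (Fin n), ‖w‖ = 1 → ∀ t ∈ timeSet T,
        (∫ ρ in Set.Ioc 0 (t + R),
            (radon n (fun x => |u x t|) w ρ) ^ p * (t - ρ + R) ^ (-(((n : ℝ) - 1) * p / 2)) *
              ρ ^ ((n : ℝ) - 1 - ((n : ℝ) - 1) * p / 2)) ≤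
          C * ∫ x, |u x t| ^ p := by
  have hp0 : 0 < p := by linarith
  have hb0 : 0 < 1 - 1 / p := by
    have : 1 / p < 1 := by rwa [div_lt_one hp0]
    linarith
  have hS : 0 < sphereArea n := sphereArea_pos (by omega)
  have hS' : 0 < sphereArea (n - 1) := sphereArea_pos (by omega)
  refine ⟨(sphereArea (n - 1) * 2 ^ (((n : ℝ) - 3) / 2)) ^ p * (1 - 1 / p) ^ (-p) / sphereArea n,
    by positivity, fun w hw t ht => ?_⟩
  have hcont : Continuous fun r : ℝ => |u (r • w) t| := by
    refine Continuous.abs (hreg.continuousOn.comp_continuous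
      (f := fun r : ℝ => (r • w, t)) (by fun_prop) fun r => ⟨mem_univ _, ht⟩)
  have hu : ∀ x, |u x t| = |u (‖x‖ • w) t| := fun x => by
    rw [hradial x, hradial (‖x‖ • w), norm_smul, norm_norm, hw, mul_one]
  have h := setIntegral_radon_radial_le (by omega) hp hp2 hcont (fun _ => abs_nonneg _)
    (A := t + R) (fun r hr => by
      rw [hsupp (r • w) t ht, abs_zero]
      rw [norm_smul, hw, mul_one]
      exact hr.trans_le (le_abs_self r)) hw
  simp only [← hu] at h
  simpa only [show ∀ ρ, t - ρ + R = t + R - ρ from fun ρ => by ring] using h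
end
end
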